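/- arXiv:2505.09535 — 2 statements merged into one kernel-verified Lean document; each statement's English description precedes it below -/
import Mathlib

section
/- For all nonnegative integers k, r, t: if r ≥ k then ∑_{j=0}^{k} (−1)^j · C(k,j) · α(r,t,j) = 2^k · r! · C(t,r) · C(t+r−k, r−k), and if r < k then ∑_{j=0}^{k} (−1)^j · C(k,j) · α(r,t,j) = 0. -/
/-- The generalized binomial coefficient `C(x,m) = x(x-1)⋯(x-m+1)/m!`. -/
noncomputable def gbinom (x : ℚ) (m : ℕ) : ℚ :=
  (∏ i ∈ Finset.range m, (x - (i : ℚ))) / (m.factorial : ℚ)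

/-- `α(r,t,j) = ∑_{h=0}^{r} (−1)^h · ((2h)!·(2(r−h))!)/(h!·(r−h)!) · C(j,2h) · C(t+r−j,2(r−h))`. -/
noncomputable def alphaQ (r : ℕ) (t j : ℚ) : ℚ :=
  ∑ h ∈ Finset.range (r + 1),
    (-1 : ℚ) ^ h * (((2 * h).factorial : ℚ) * ((2 * (r - h)).factorial : ℚ)) /
        ((h.factorial : ℚ) * ((r - h).factorial : ℚ)) *
      gbinom j (2 * h) * gbinom (t + (r : ℚ) - j) (2 * (r - h))

/-- The value at `x` of the falling factorial `x(x-1)⋯(x-m+1)`. -/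
noncomputable def fallingQ (x : ℚ) (m : ℕ) : ℚ :=
  ∏ i ∈ Finset.range m, (x - (i : ℚ))

theorem fallingQ_zero (x : ℚ) : fallingQ x 0 = 1 := by
  simp [fallingQ]

theorem fallingQ_succ (x : ℚ) (m : ℕ) : fallingQ x (m + 1) = x * fallingQ (x - 1) m := by
  rw [fallingQ, Finset.prod_range_succ', fallingQ, mul_comm]
  congr 1
  · simp
  · refine Finset.prod_congr rfl fun i _ => ?_
    push_cast
    ring

theorem fallingQ_add_two (x : ℚ) (m : ℕ) :
    fallingQ x (m + 2) = x * (x - 1) * fallingQ (x - 2) m := by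
  rw [fallingQ_succ, fallingQ_succ, show x - 1 - 1 = x - 2 by ring, mul_assoc]

theorem fallingQ_add (x : ℚ) (m n : ℕ) :
    fallingQ x (m + n) = fallingQ x m * fallingQ (x - m) n := by
  rw [fallingQ, Finset.prod_range_add, fallingQ, fallingQ]
  congr 1
  refine Finset.prod_congr rfl fun i _ => ?_
  push_cast
  ring

theorem gbinom_eq_fallingQ_div (x : ℚ) (m : ℕ) : gbinom x m = fallingQ x m / m.factorial := rfl

/-- The value at `(1, 1)` of `(∂_Y² - ∂_X²)^r` applied to `X^x Y^y`. -/
noncomputable def waveQ (r : ℕ) (x y : ℚ) : ℚ :=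
  ∑ p ∈ Finset.HasAntidiagonal.antidiagonal r,
    (r.choose p.1 : ℚ) * ((-1) ^ p.1 * fallingQ x (2 * p.1) * fallingQ y (2 * p.2))

theorem waveQ_zero (x y : ℚ) : waveQ 0 x y = 1 := by
  simp [waveQ, fallingQ_zero]

theorem waveQ_succ (r : ℕ) (x y : ℚ) :
    waveQ (r + 1) x y = y * (y - 1) * waveQ r x (y - 2) - x * (x - 1) * waveQ r (x - 2) y := by
  have h := Finset.sum_antidiagonal_choose_succ_mul
    (fun a b => (-1 : ℚ) ^ a * fallingQ x (2 * a) * fallingQ y (2 * b)) r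
  rw [waveQ, h, waveQ, waveQ, Finset.mul_sum, Finset.mul_sum, sub_eq_add_neg,
    ← Finset.sum_neg_distrib]
  congr 1
  · refine Finset.sum_congr rfl fun p _ => ?_
    rw [mul_add_one, fallingQ_add_two]
    ring
  · refine Finset.sum_congr rfl fun p hp => ?_
    rw [Nat.choose_symm_of_eq_add (Finset.HasAntidiagonal.mem_antidiagonal.mp hp).symm, mul_add_one,
      fallingQ_add_two]
    ring

theorem alphaQ_eq_waveQ_div (r : ℕ) (t j : ℚ) :
    alphaQ r t j = waveQ r j (t + r - j) / r.factorial := by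
  rw [waveQ, Finset.Nat.sum_antidiagonal_eq_sum_range_succ_mk, Finset.sum_div, alphaQ]
  refine Finset.sum_congr rfl fun h hh => ?_
  rw [Nat.cast_choose ℚ (Finset.mem_range_succ_iff.mp hh), gbinom_eq_fallingQ_div,
    gbinom_eq_fallingQ_div]
  have := r.factorial_ne_zero
  have := h.factorial_ne_zero
  have := (r - h).factorial_ne_zero
  have := (2 * h).factorial_ne_zero
  have := (2 * (r - h)).factorial_ne_zero
  field_simp

/-- The value at `(1, 1)` of `(∂_Y² - ∂_X²)^r` applied to `(Y - X)^k Y^b`. -/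
noncomputable def altWaveQ (r k : ℕ) (b : ℚ) : ℚ :=
  ∑ j ∈ Finset.range (k + 1), (-1 : ℚ) ^ j * (k.choose j : ℚ) * waveQ r j (b + k - j)

theorem choose_add_two_mul (k j : ℕ) :
    (k.choose (j + 2) : ℚ) * ((j + 2) * (j + 1)) = k.choose j * ((k - j) * (k - j - 1)) := by
  have step (i : ℕ) : (k.choose (i + 1) : ℚ) * (i + 1) = k.choose i * (k - i) := by
    rcases le_or_gt i k with hi | hi
    · have := k.choose_succ_right_eq i
      rw [← Nat.cast_sub hi]
      exact_mod_cast this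
    · simp [Nat.choose_eq_zero_of_lt hi, Nat.choose_eq_zero_of_lt (hi.trans i.lt_succ_self)]
  have h₁ := step (j + 1)
  push_cast at h₁
  linear_combination ((j : ℚ) + 1) * h₁ + ((k : ℚ) - j - 1) * step j

theorem altWaveQ_succ_eq_sum (r k : ℕ) (b : ℚ) :
    altWaveQ (r + 1) k b = b * (b - 1) * altWaveQ r k (b - 2) +
      2 * b * ∑ j ∈ Finset.range (k + 1),
        (-1 : ℚ) ^ j * ((k.choose j : ℚ) * (k - j)) * waveQ r j (b - 2 + k - j) := by
  have shift : ∑ j ∈ Finset.range (k + 1), (-1 : ℚ) ^ j * (k.choose j : ℚ) *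
        ((j : ℚ) * (j - 1) * waveQ r ((j : ℚ) - 2) (b + k - j)) =
      ∑ j ∈ Finset.range (k + 1), (-1 : ℚ) ^ j * ((k.choose j : ℚ) * ((k - j) * (k - j - 1))) *
        waveQ r j (b - 2 + k - j) := by
    trans ∑ j ∈ Finset.range (k + 1 + 2), (-1 : ℚ) ^ j * (k.choose j : ℚ) *
        ((j : ℚ) * (j - 1) * waveQ r ((j : ℚ) - 2) (b + k - j))
    · rw [Finset.sum_range_succ _ (k + 2), Finset.sum_range_succ _ (k + 1)]
      simp [Nat.choose_eq_zero_of_lt (show k < k + 2 by omega)]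
    · rw [Finset.sum_range_succ' _ (k + 2), Finset.sum_range_succ' _ (k + 1)]
      simp only [Nat.cast_zero, Nat.cast_one, zero_add, sub_self, mul_zero, zero_mul, add_zero]
      refine Finset.sum_congr rfl fun j _ => ?_
      rw [← choose_add_two_mul]
      push_cast
      rw [show (j : ℚ) + 1 + 1 - 2 = j by ring,
        show b + k - ((j : ℚ) + 1 + 1) = b - 2 + k - j by ring]
      ring
  simp only [altWaveQ, waveQ_succ, mul_sub ((-1 : ℚ) ^ _ * (k.choose _ : ℚ))]
  rw [Finset.sum_sub_distrib, shift, Finset.mul_sum, Finset.mul_sum, ← Finset.sum_sub_distrib,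
    ← Finset.sum_add_distrib]
  refine Finset.sum_congr rfl fun j _ => ?_
  rw [show b + k - (j : ℚ) - 2 = b - 2 + k - j by ring]
  ring

theorem altWaveQ_succ_zero (r : ℕ) (b : ℚ) :
    altWaveQ (r + 1) 0 b = b * (b - 1) * altWaveQ r 0 (b - 2) := by
  simp [altWaveQ_succ_eq_sum]

theorem altWaveQ_succ_succ (r k : ℕ) (b : ℚ) :
    altWaveQ (r + 1) (k + 1) b = b * (b - 1) * altWaveQ r (k + 1) (b - 2) +
      2 * (k + 1) * b * altWaveQ r k (b - 1) := by
  rw [altWaveQ_succ_eq_sum, Finset.sum_range_succ _ (k + 1), altWaveQ.eq_def r k, sub_self,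
    mul_zero, mul_zero, zero_mul, add_zero, Finset.mul_sum, Finset.mul_sum]
  congr 1
  refine Finset.sum_congr rfl fun j hj => ?_
  have hj' : j ≤ k := Finset.mem_range_succ_iff.mp hj
  have h : ((k + 1).choose j : ℚ) * ((k + 1 : ℕ) - j) = (k + 1) * k.choose j := by
    rw [← Nat.cast_sub (hj'.trans k.le_succ)]
    exact_mod_cast (Nat.choose_mul_succ_eq k j).symm.trans (mul_comm _ _)
  rw [h, show b - 2 + ((k + 1 : ℕ) : ℚ) - j = b - 1 + k - j by push_cast; ring]
  ring

theorem altWaveQ_zero_left (k : ℕ) (b : ℚ) : altWaveQ 0 k b = if k = 0 then 1 else 0 := by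
  simp only [altWaveQ, waveQ_zero, mul_one]
  exact_mod_cast Int.alternating_sum_range_choose (n := k)

theorem altWaveQ_eq (r k : ℕ) (b : ℚ) :
    altWaveQ r k b = r.choose k * (2 ^ k * k.factorial * fallingQ b (2 * r - k)) := by
  induction r generalizing k b with
  | zero =>
    rw [altWaveQ_zero_left]
    cases k <;> simp [fallingQ_zero]
  | succ r ih =>
    cases k with
    | zero =>
      rw [altWaveQ_succ_zero, ih]
      simp [mul_add_one, fallingQ_add_two]
    | succ k =>
      rw [altWaveQ_succ_succ, ih, ih]
      have h₁ : (r.choose (k + 1) : ℚ) * fallingQ b (2 * (r + 1) - (k + 1)) =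
          r.choose (k + 1) * (b * (b - 1) * fallingQ (b - 2) (2 * r - (k + 1))) := by
        rcases lt_or_ge r (k + 1) with h | h
        · simp [Nat.choose_eq_zero_of_lt h]
        · rw [show 2 * (r + 1) - (k + 1) = 2 * r - (k + 1) + 2 by omega, fallingQ_add_two]
      have h₂ : (r.choose k : ℚ) * fallingQ b (2 * (r + 1) - (k + 1)) =
          r.choose k * (b * fallingQ (b - 1) (2 * r - k)) := by
        rcases lt_or_ge r k with h | h
        · simp [Nat.choose_eq_zero_of_lt h]
        · rw [show 2 * (r + 1) - (k + 1) = 2 * r - k + 1 by omega, fallingQ_succ]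
      rw [Nat.choose_succ_succ, Nat.factorial_succ]
      push_cast
      linear_combination (-(2 : ℚ) ^ (k + 1) * (k + 1) * k.factorial) * (h₁ + h₂)

theorem sum_alphaQ_eq_altWaveQ_div (k r t : ℕ) :
    ∑ j ∈ Finset.range (k + 1), (-1 : ℚ) ^ j * (k.choose j : ℚ) * alphaQ r (t : ℚ) (j : ℚ) =
      altWaveQ r k ((t : ℚ) + r - k) / r.factorial := by
  rw [altWaveQ, Finset.sum_div]
  refine Finset.sum_congr rfl fun j _ => ?_
  rw [alphaQ_eq_waveQ_div, sub_add_cancel, mul_div_assoc]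

/-- The alternating sum `∑_{j=0}^{k} (−1)^j·C(k,j)·α(r,t,j)` equals
`2^k·r!·C(t,r)·C(t+r−k, r−k)` when `r ≥ k`, and vanishes when `r < k`. -/
theorem alt_sum_choose_alphaQ (k r t : ℕ) :
    (r ≥ k →
      ∑ j ∈ Finset.range (k + 1), (-1 : ℚ) ^ j * (k.choose j : ℚ) * alphaQ r (t : ℚ) (j : ℚ) =
        2 ^ k * (r.factorial : ℚ) * gbinom (t : ℚ) r *
          gbinom ((t : ℚ) + (r : ℚ) - (k : ℚ)) (r - k)) ∧
    (r < k →
      ∑ j ∈ Finset.range (k + 1), (-1 : ℚ) ^ j * (k.choose j : ℚ) * alphaQ r (t : ℚ) (j : ℚ) =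
        0) := by
  rw [sum_alphaQ_eq_altWaveQ_div, altWaveQ_eq]
  refine ⟨fun h => ?_, fun h => by simp [Nat.choose_eq_zero_of_lt h]⟩
  have hsplit : fallingQ ((t : ℚ) + r - k) (2 * r - k) =
      fallingQ ((t : ℚ) + r - k) (r - k) * fallingQ t r := by
    rw [show 2 * r - k = r - k + r by omega, fallingQ_add, Nat.cast_sub h]
    congr 2
    ring
  rw [hsplit, Nat.cast_choose ℚ h, gbinom_eq_fallingQ_div, gbinom_eq_fallingQ_div]
  have := r.factorial_ne_zero
  have := k.factorial_ne_zero
  have := (r - k).factorial_ne_zero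
  field_simp
end

section
/- For every rational number a and every positive integer m, ((2m)!/m!) · C(a, 2m) = ((2m)!/m!) · C(a−1, 2m) + 2(a−1) · ((2m−2)!/(m−1)!) · C(a−2, 2m−2). (This is the coefficientwise form of the recursion f_a(x) − f_{a−1}(x) − 2(a−1)·x·f_{a−2}(x) = 0 for the polynomials f_a(x) = ∑_{m≥0} ((2m)!/m!) · C(a,2m) · x^m, which are the Hermite orthogonal polynomials up to a change of variables.) -/
/-- Clearing the denominator in `gbinom` gives the falling factorial. -/
theorem factorial_mul_gbinom (x : ℚ) (n : ℕ) :
    (n.factorial : ℚ) * gbinom x n = ∏ i ∈ Finset.range n, (x - (i : ℚ)) :=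
  mul_div_cancel₀ _ (Nat.cast_ne_zero.mpr n.factorial_ne_zero)

/-- Splitting off the first factor of a falling factorial. -/
theorem prod_range_succ_sub_natCast {R : Type*} [CommRing R] (x : R) (n : ℕ) :
    ∏ i ∈ Finset.range (n + 1), (x - (i : R)) =
      x * ∏ i ∈ Finset.range n, (x - 1 - (i : R)) := by
  rw [Finset.prod_range_succ', mul_comm]
  simp [sub_sub, add_comm]

/-- Coefficientwise form of the Hermite-polynomial recursion
`f_a(x) − f_{a−1}(x) − 2(a−1)·x·f_{a−2}(x) = 0` for
`f_a(x) = ∑_{m≥0} ((2m)!/m!)·C(a,2m)·x^m`. -/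
theorem hermite_recursion (a : ℚ) (m : ℕ) (hm : 1 ≤ m) :
    ((2 * m).factorial : ℚ) / (m.factorial : ℚ) * gbinom a (2 * m) =
      ((2 * m).factorial : ℚ) / (m.factorial : ℚ) * gbinom (a - 1) (2 * m) +
        2 * (a - 1) * (((2 * m - 2).factorial : ℚ) / ((m - 1).factorial : ℚ)) *
          gbinom (a - 2) (2 * m - 2) := by
  obtain ⟨k, rfl⟩ : ∃ k, m = k + 1 := ⟨m - 1, by omega⟩
  have hk : (k.factorial : ℚ) ≠ 0 := Nat.cast_ne_zero.mpr k.factorial_ne_zero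
  have hk1 : (k : ℚ) + 1 ≠ 0 := by positivity
  have h2 : 2 * (k + 1) - 2 = 2 * k := by omega
  have h_top : ((2 * (k + 1)).factorial : ℚ) * gbinom a (2 * (k + 1)) =
      a * ((a - 1) * ∏ i ∈ Finset.range (2 * k), (a - 2 - (i : ℚ))) := by
    rw [factorial_mul_gbinom, show 2 * (k + 1) = 2 * k + 1 + 1 by ring,
      prod_range_succ_sub_natCast, prod_range_succ_sub_natCast, sub_sub a 1 1, one_add_one_eq_two]
  have h_shift : ((2 * (k + 1)).factorial : ℚ) * gbinom (a - 1) (2 * (k + 1)) =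
      (a - 1) * (∏ i ∈ Finset.range (2 * k), (a - 2 - (i : ℚ))) * (a - 2 * (k + 1)) := by
    rw [factorial_mul_gbinom, show 2 * (k + 1) = 2 * k + 1 + 1 by ring,
      Finset.prod_range_succ, prod_range_succ_sub_natCast, sub_sub a 1 1, one_add_one_eq_two]
    push_cast
    ring
  rw [h2, Nat.add_sub_cancel, div_mul_eq_mul_div, div_mul_eq_mul_div, h_top, h_shift,
    mul_assoc (2 * (a - 1)), div_mul_eq_mul_div, factorial_mul_gbinom, Nat.factorial_succ]
  push_cast
  field_simp
  ring
end
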